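/- For every integer n ≥ 1 and every integer j with 0 ≤ j ≤ n−1, the polynomials ∑_{k=0}^{n} ([n, k]_q)² and [2n, n]_q take the same value at q = ξ_n^j; that is, ∑_{k=0}^{n} ([n, k]_q(ξ_n^j))² = [2n, n]_q(ξ_n^j). -/

import Mathlib

/-- The Gaussian (q-)binomial coefficient `[n, k]_q` as a polynomial in `ℤ[q]`,
defined by `[n, 0] = 1`, `[0, k+1] = 0` and
`[n+1, k+1] = [n, k] + q^(k+1) * [n, k+1]` (so `[n, k] = 0` for `k > n`). -/
noncomputable def gaussBinom : ℕ → ℕ → Polynomial ℤ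
  | _, 0 => 1
  | 0, _ + 1 => 0
  | n + 1, k + 1 => gaussBinom n k + Polynomial.X ^ (k + 1) * gaussBinom n (k + 1)

theorem gaussBinom_zero_right (n : ℕ) : gaussBinom n 0 = 1 := by
  cases n <;> rfl

open Polynomial in
theorem gaussBinom_succ_succ (n k : ℕ) :
    gaussBinom (n + 1) (k + 1) = gaussBinom n k + X ^ (k + 1) * gaussBinom n (k + 1) := rfl

theorem gaussBinom_eq_zero_of_lt {n k : ℕ} (h : n < k) : gaussBinom n k = 0 := by
  induction n generalizing k with
  | zero =>
    obtain ⟨k, rfl⟩ := Nat.exists_eq_succ_of_ne_zero h.ne'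
    rfl
  | succ n ih =>
    obtain ⟨k, rfl⟩ := Nat.exists_eq_succ_of_ne_zero (Nat.ne_zero_of_lt h)
    rw [Nat.succ_eq_add_one, gaussBinom_succ_succ, ih (by omega), ih (by omega)]
    simp

theorem gaussBinom_self (n : ℕ) : gaussBinom n n = 1 := by
  induction n with
  | zero => rfl
  | succ n ih => simp [gaussBinom_succ_succ, ih, gaussBinom_eq_zero_of_lt (Nat.lt_succ_self n)]

open Polynomial in
theorem one_sub_X_pow_mul_gaussBinom_succ_right {n i j : ℕ} (h : i + j = n) :
    (1 - X ^ (i + 1)) * gaussBinom n (i + 1) = (1 - X ^ j) * gaussBinom n i := by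
  induction n generalizing i j with
  | zero =>
    obtain ⟨rfl, rfl⟩ : i = 0 ∧ j = 0 := by omega
    simp [gaussBinom_eq_zero_of_lt]
  | succ n ih =>
    rcases j with _ | j
    · simp [gaussBinom_eq_zero_of_lt (show n + 1 < i + 1 by omega)]
    · have h₁ := ih (i := i) (j := j) (by omega)
      rcases i with _ | i
      · rw [gaussBinom_succ_succ]
        simp only [gaussBinom_zero_right] at h₁ ⊢
        linear_combination X * h₁
      · have h₂ := ih (i := i) (j := j + 1) (by omega)
        rw [gaussBinom_succ_succ n (i + 1), gaussBinom_succ_succ n i]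
        linear_combination X ^ (i + 2) * h₁ + h₂

open Polynomial in
/-- The absorption identity for Gaussian binomial coefficients. -/
theorem one_sub_X_pow_mul_gaussBinom_succ_succ {n k : ℕ} (h : k ≤ n) :
    (1 - X ^ (k + 1)) * gaussBinom (n + 1) (k + 1) = (1 - X ^ (n + 1)) * gaussBinom n k := by
  obtain ⟨j, rfl⟩ := Nat.exists_eq_add_of_le h
  rw [gaussBinom_succ_succ]
  linear_combination X ^ (k + 1) * one_sub_X_pow_mul_gaussBinom_succ_right (rfl : k + j = k + j)

open Polynomial in
theorem gaussBinom_symm {n i j : ℕ} (h : i + j = n) : gaussBinom n i = gaussBinom n j := by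
  induction n generalizing i j with
  | zero =>
    obtain ⟨rfl, rfl⟩ : i = 0 ∧ j = 0 := by omega
    rfl
  | succ n ih =>
    rcases i with _ | i
    · obtain rfl : j = n + 1 := by omega
      rw [gaussBinom_zero_right, gaussBinom_self]
    · rcases j with _ | j
      · obtain rfl : i = n := by omega
        rw [gaussBinom_zero_right, gaussBinom_self]
      · rw [gaussBinom_succ_succ, gaussBinom_succ_succ,
          ← ih (i := i + 1) (j := j) (by omega), ← ih (i := i) (j := j + 1) (by omega)]
        linear_combination
          -one_sub_X_pow_mul_gaussBinom_succ_right (show i + (j + 1) = n by omega)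

open Polynomial in
/-- The `q`-Vandermonde identity. -/
theorem gaussBinom_add (m n k : ℕ) :
    gaussBinom (m + n) k = ∑ p ∈ Finset.HasAntidiagonal.antidiagonal k,
      gaussBinom m p.1 * gaussBinom n p.2 * X ^ (p.2 * (m - p.1)) := by
  induction m generalizing k with
  | zero =>
    rcases k with _ | k
    · simp [gaussBinom_zero_right]
    · rw [Finset.Nat.sum_antidiagonal_succ]
      simp [gaussBinom_zero_right, gaussBinom_eq_zero_of_lt]
  | succ m ih =>
    rcases k with _ | k
    · simp [gaussBinom_zero_right]
    · rw [Nat.add_right_comm, gaussBinom_succ_succ, ih, ih, Finset.Nat.sum_antidiagonal_succ,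
        Finset.Nat.sum_antidiagonal_succ, mul_add, Finset.mul_sum, add_left_comm,
        ← Finset.sum_add_distrib]
      simp only [gaussBinom_zero_right]
      congr 1
      · simp only [Nat.sub_zero]
        ring
      · refine Finset.sum_congr rfl fun p hp => ?_
        obtain ⟨i, j⟩ := p
        obtain rfl : i + j = k := by simpa using hp
        simp only [gaussBinom_succ_succ, Nat.add_sub_add_right]
        rcases lt_or_ge m (i + 1) with h | h
        · rw [gaussBinom_eq_zero_of_lt h]
          ring
        · obtain ⟨l, rfl⟩ := Nat.exists_eq_add_of_le h
          rw [Nat.add_sub_cancel_left, show i + 1 + l - i = l + 1 by omega]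
          ring

open Polynomial in
theorem aeval_gaussBinom_eq_zero {R : Type*} [CommRing R] [IsDomain R] {x : R} {n k : ℕ}
    (hn : x ^ n = 1) (hkn : k ≤ n) (hk : x ^ k ≠ 1) : aeval x (gaussBinom n k) = 0 := by
  rcases k with _ | k
  · simp at hk
  obtain ⟨n, rfl⟩ := Nat.exists_eq_succ_of_ne_zero (show n ≠ 0 by omega)
  have h := congrArg (aeval x)
    (one_sub_X_pow_mul_gaussBinom_succ_succ (show k ≤ n by omega))
  simp only [map_mul, map_sub, map_one, map_pow, aeval_X] at h
  rw [Nat.succ_eq_add_one] at hn ⊢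
  rw [hn, sub_self, zero_mul] at h
  exact (mul_eq_zero.mp h).resolve_left (sub_ne_zero.mpr hk.symm)

open Polynomial in
theorem sum_aeval_gaussBinom_sq {R : Type*} [CommRing R] [IsDomain R] {x : R} {n : ℕ}
    (hx : x ^ n = 1) :
    ∑ k ∈ Finset.range (n + 1), aeval x (gaussBinom n k) ^ 2 =
      aeval x (gaussBinom (2 * n) n) := by
  rw [two_mul, gaussBinom_add, map_sum, Finset.Nat.sum_antidiagonal_eq_sum_range_succ_mk]
  refine Finset.sum_congr rfl fun k hk => ?_
  have hk : k ≤ n := Nat.lt_succ_iff.mp (Finset.mem_range.mp hk)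
  rw [gaussBinom_symm (Nat.add_sub_cancel' hk)]
  simp only [map_mul, map_pow, aeval_X, pow_mul]
  by_cases h : x ^ (n - k) = 1
  · rw [h, one_pow, mul_one, sq]
  · rw [aeval_gaussBinom_eq_zero hx (Nat.sub_le n k) h]
    ring

/-- for `n ≥ 1` and `0 ≤ j ≤ n - 1`, the polynomials
`∑_{k=0}^{n} ([n,k]_q)²` and `[2n, n]_q` take the same value at `q = ξ_n^j`. -/
theorem stmt12 (n : ℕ) (hn : 1 ≤ n) (j : ℕ) (hj : j ≤ n - 1) :
    ∑ k ∈ Finset.range (n + 1),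
      (Polynomial.aeval (Complex.exp (2 * Real.pi * Complex.I / n) ^ j)
        (gaussBinom n k)) ^ 2
    = Polynomial.aeval (Complex.exp (2 * Real.pi * Complex.I / n) ^ j)
        (gaussBinom (2 * n) n) := by
  refine sum_aeval_gaussBinom_sq ?_
  rw [pow_right_comm, (Complex.isPrimitiveRoot_exp n (by omega)).pow_eq_one, one_pow]
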